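/- Let 𝒜 be a relational structure whose Gaifman graph is connected and has diameter at most D, and let 𝒯 be a tree-decomposition or path-decomposition of 𝒜 of span at most δ in which every bag is nonempty. Then any two nodes of the decomposition tree are at distance at most δ·(D + 1) from each other; in particular the decomposition tree has diameter at most δ·(D+1). -/

import Mathlib

open FirstOrder Language

namespace Paper

/-- The Gaifman graph of an `L`-structure: two distinct elements are adjacent iff they occur
together in some tuple of some relation. -/
def gaifman (L : Language) {M : Type*} (sM : L.Structure M) : SimpleGraph M :=
  SimpleGraph.fromRel (fun x y =>
    ∃ (n : ℕ) (R : L.Relations n) (v : Fin n → M),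
      sM.RelMap R v ∧ x ∈ Set.range v ∧ y ∈ Set.range v)

/-- `(tr, bag)` is a tree-decomposition of the `L`-structure `M`: `tr` is a tree, the bags
are nonempty sets of elements, every element lies in some bag, every tuple of every relation
is contained in some bag, and for every element the set of nodes whose bag contains it
induces a connected subgraph of `tr`.  (Path-decompositions are the special case in which
`tr` is a path, so statements proved for all tree-decompositions cover both cases.) -/
def IsTreeDecStruct (L : Language) {M T : Type*} (sM : L.Structure M)
    (tr : SimpleGraph T) (bag : T → Set M) : Prop :=
  tr.IsTree ∧ (∀ t, (bag t).Nonempty) ∧ (∀ x, ∃ t, x ∈ bag t) ∧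
    (∀ (n : ℕ) (R : L.Relations n) (v : Fin n → M), sM.RelMap R v → ∃ t, ∀ i, v i ∈ bag t) ∧
    (∀ x, (tr.induce {t | x ∈ bag t}).Connected)

/-- The decomposition has span at most `δ`: any two nodes whose bags contain a common
element are at distance at most `δ` in the decomposition tree. -/
def SpanLE {V T : Type*} (tr : SimpleGraph T) (bag : T → Set V) (δ : ℕ) : Prop :=
  ∀ v t u, v ∈ bag t → v ∈ bag u → tr.dist t u ≤ δ

/-- Adjacent elements of the Gaifman graph occur together in some bag. -/
theorem IsTreeDecStruct.exists_mem_bag_of_adj {L : Language} {M T : Type*} {sM : L.Structure M}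
    {tr : SimpleGraph T} {bag : T → Set M} (hdec : IsTreeDecStruct L sM tr bag) {x y : M}
    (h : (gaifman L sM).Adj x y) : ∃ t, x ∈ bag t ∧ y ∈ bag t := by
  obtain ⟨-, -, -, htuple, -⟩ := hdec
  rw [gaifman, SimpleGraph.fromRel_adj] at h
  obtain ⟨-, ⟨n, R, v, hv, ⟨i, rfl⟩, ⟨j, rfl⟩⟩ | ⟨n, R, v, hv, ⟨i, rfl⟩, ⟨j, rfl⟩⟩⟩ := h
  all_goals
    obtain ⟨t, ht⟩ := htuple n R v hv
    exact ⟨t, ht _, ht _⟩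

/-- A walk of length `n` in the Gaifman graph bounds by `δ * (n + 1)` the distance between nodes
whose bags contain its endpoints. -/
theorem IsTreeDecStruct.dist_le_of_walk {L : Language} {M T : Type*} {sM : L.Structure M}
    {tr : SimpleGraph T} {bag : T → Set M} {δ : ℕ} (hdec : IsTreeDecStruct L sM tr bag)
    (hspan : SpanLE tr bag δ) {x y : M} (p : (gaifman L sM).Walk x y) {t u : T}
    (hx : x ∈ bag t) (hy : y ∈ bag u) : tr.dist t u ≤ δ * (p.length + 1) := by
  induction p generalizing t with
  | nil => simpa using hspan _ _ _ hx hy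
  | cons h p ih =>
    obtain ⟨s, hxs, hzs⟩ := hdec.exists_mem_bag_of_adj h
    calc tr.dist t u ≤ tr.dist t s + tr.dist s u := hdec.1.connected.dist_triangle
      _ ≤ δ + δ * (p.length + 1) := Nat.add_le_add (hspan _ _ _ hx hxs) (ih hzs hy)
      _ = δ * ((SimpleGraph.Walk.cons h p).length + 1) := by
        rw [SimpleGraph.Walk.length_cons]; ring

/-- If the Gaifman graph of a structure is connected of diameter at most
`D`, then in any tree-decomposition (hence in particular any path-decomposition) of span at
most `δ` of the structure (all of whose bags are nonempty), any two nodes of the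
decomposition tree are at distance at most `δ·(D+1)`; in particular the decomposition tree
has diameter at most `δ·(D+1)`. -/
theorem dec_diameter_le (L : Language) {M T : Type} (sM : L.Structure M)
    (tr : SimpleGraph T) (bag : T → Set M) (δ D : ℕ)
    (hconn : (gaifman L sM).Connected)
    (hdiam : ∀ x y : M, (gaifman L sM).dist x y ≤ D)
    (hdec : IsTreeDecStruct L sM tr bag) (hspan : SpanLE tr bag δ) :
    ∀ t u : T, tr.dist t u ≤ δ * (D + 1) := by
  intro t u
  obtain ⟨x, hx⟩ := hdec.2.1 t
  obtain ⟨y, hy⟩ := hdec.2.1 u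
  obtain ⟨p, hp⟩ := hconn.exists_walk_length_eq_dist x y
  calc tr.dist t u ≤ δ * (p.length + 1) := hdec.dist_le_of_walk hspan p hx hy
    _ ≤ δ * (D + 1) := by
      rw [hp]
      exact Nat.mul_le_mul_left δ (Nat.succ_le_succ (hdiam x y))

end Paper
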